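/- Let n ≥ 1, θ > 1 and let u : ℝⁿ → ℝ be C¹ on ℝⁿ and C³ on {|∇u| > 0}, satisfying div(∇u/√(1+|∇u|²)) = log^{θ}(1 + |∇u|²) on all of ℝⁿ. Then u is constant. -/

import Mathlib

open Metric Real Filter

noncomputable def pd1 {n : ℕ} (u : EuclideanSpace ℝ (Fin n) → ℝ) (i : Fin n)
    (x : EuclideanSpace ℝ (Fin n)) : ℝ :=
  fderiv ℝ u x (EuclideanSpace.single i 1)

noncomputable def pd2 {n : ℕ} (u : EuclideanSpace ℝ (Fin n) → ℝ) (i j : Fin n)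
    (x : EuclideanSpace ℝ (Fin n)) : ℝ :=
  fderiv ℝ (pd1 u j) x (EuclideanSpace.single i 1)

/-- The coefficients `a^{ij} = δ^{ij} - u_i u_j / (1 + |∇u|²)` of the
nondivergence form of the mean curvature operator. -/
noncomputable def aCoef {n : ℕ} (u : EuclideanSpace ℝ (Fin n) → ℝ) (i j : Fin n)
    (x : EuclideanSpace ℝ (Fin n)) : ℝ :=
  (if i = j then (1 : ℝ) else 0) - pd1 u i x * pd1 u j x / (1 + ‖gradient u x‖ ^ 2)

/-- The mean curvature operator in nondivergence form: `a^{ij} u_{ij}`. -/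
noncomputable def mcOp {n : ℕ} (u : EuclideanSpace ℝ (Fin n) → ℝ)
    (x : EuclideanSpace ℝ (Fin n)) : ℝ :=
  ∑ i, ∑ j, aCoef u i j x * pd2 u i j x

open Topology RealInnerProductSpace

/-- Necessary second-order condition at a local maximum on the line. -/
lemma IsLocalMax.second_deriv_nonpos {f f' : ℝ → ℝ} {f'' a : ℝ} (hmax : IsLocalMax f a)
    (h1 : ∀ᶠ t in 𝓝 a, HasDerivAt f (f' t) t) (h2 : HasDerivAt f' f'' a) : f'' ≤ 0 := by
  by_contra! hpos
  have hd : deriv f =ᶠ[𝓝 a] f' := h1.mono fun t ht => ht.deriv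
  have hdd : deriv (deriv f) a = f'' := by rw [hd.deriv_eq, h2.deriv]
  have hmin := isLocalMin_of_deriv_deriv_pos (hdd ▸ hpos) hmax.deriv_eq_zero
    h1.self_of_nhds.continuousAt
  have hconst : f =ᶠ[𝓝 a] fun _ => f a := by
    filter_upwards [hmax, hmin] with t ht ht' using le_antisymm ht ht'
  have hd0 : deriv f =ᶠ[𝓝 a] fun _ => 0 := by
    filter_upwards [hconst.deriv] with t ht using by rw [ht, deriv_const]
  have : f'' = 0 := by rw [← hdd, hd0.deriv_eq, deriv_const]
  exact hpos.ne' this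

/-- A frame `b` with `∑ b_k ⊗ b_k = I - p ⊗ p / (1 + |p|²)`. -/
lemma exists_frame_sum {n : ℕ} (p : EuclideanSpace ℝ (Fin n)) :
    ∃ b : Fin n → EuclideanSpace ℝ (Fin n),
      ∀ Q : EuclideanSpace ℝ (Fin n) →ₗ[ℝ] EuclideanSpace ℝ (Fin n) →ₗ[ℝ] ℝ,
        ∑ k, Q (b k) (b k) =
          ∑ k, Q (EuclideanSpace.single k 1) (EuclideanSpace.single k 1)
            - Q p p / (1 + ‖p‖ ^ 2) := by
  set σ := √(1 + ‖p‖ ^ 2) with hσ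
  have hσ2 : σ ^ 2 = 1 + ‖p‖ ^ 2 := Real.sq_sqrt (by positivity)
  have hσ0 : 0 < σ := Real.sqrt_pos.2 (by positivity)
  set s := 1 / (σ * (σ + 1)) with hs
  have hs2 : -2 * s + s ^ 2 * ‖p‖ ^ 2 = -(1 / (1 + ‖p‖ ^ 2)) := by
    have : ‖p‖ ^ 2 = σ ^ 2 - 1 := by rw [hσ2]; ring
    rw [this, hs]
    have : (1 + (σ ^ 2 - 1)) = σ ^ 2 := by ring
    rw [this]
    field_simp
    ring
  refine ⟨fun k => EuclideanSpace.single k 1 - (s * p k) • p, fun Q => ?_⟩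
  have hp : ∑ k, p k • EuclideanSpace.single k (1 : ℝ) = p := by
    have := (EuclideanSpace.basisFun (Fin n) ℝ).sum_repr p
    simpa using this
  have h1 : ∑ k, p k * Q p (EuclideanSpace.single k 1) = Q p p := by
    have : Q p p = Q p (∑ k, p k • EuclideanSpace.single k (1 : ℝ)) := by rw [hp]
    rw [this]
    simp [map_sum]
  have h2 : ∑ k, p k * Q (EuclideanSpace.single k 1) p = Q p p := by
    have : Q p p = Q (∑ k, p k • EuclideanSpace.single k (1 : ℝ)) p := by rw [hp]
    rw [this]
    simp [map_sum, LinearMap.sum_apply]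
  have h3 : ∑ k, p k ^ 2 = ‖p‖ ^ 2 := (EuclideanSpace.real_norm_sq_eq p).symm
  have : ∀ k, Q (EuclideanSpace.single k 1 - (s * p k) • p)
      (EuclideanSpace.single k 1 - (s * p k) • p) =
      Q (EuclideanSpace.single k 1) (EuclideanSpace.single k 1)
      - s * (p k * Q (EuclideanSpace.single k 1) p) - s * (p k * Q p (EuclideanSpace.single k 1))
      + s ^ 2 * Q p p * p k ^ 2 := by
    intro k
    simp only [map_sub, map_smul, LinearMap.sub_apply, LinearMap.smul_apply, smul_eq_mul]
    ring
  simp only [this, Finset.sum_add_distrib, Finset.sum_sub_distrib, ← Finset.mul_sum, h1, h2, h3]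
  linear_combination Q p p * hs2

section Gradient

variable {n : ℕ} {u : EuclideanSpace ℝ (Fin n) → ℝ} {x : EuclideanSpace ℝ (Fin n)}

lemma continuous_gradient_of_contDiff (hu : ContDiff ℝ 1 u) : Continuous (gradient u) :=
  (InnerProductSpace.toDual ℝ _).symm.continuous.comp (hu.continuous_fderiv (by norm_num))

lemma inner_gradient (x h : EuclideanSpace ℝ (Fin n)) : ⟪gradient u x, h⟫ = fderiv ℝ u x h := by
  simp [gradient]

lemma pd1_eq_inner (i : Fin n) (x : EuclideanSpace ℝ (Fin n)) : pd1 u i x = gradient u x i := by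
  rw [pd1, ← inner_gradient, EuclideanSpace.inner_single_right]
  simp

lemma contDiffAt_gradient (hu : ContDiffAt ℝ 3 u x) : ContDiffAt ℝ 2 (gradient u) x :=
  (InnerProductSpace.toDual ℝ _).symm.contDiff.contDiffAt.comp x
    (hu.fderiv_right (m := 2) (by norm_num))

lemma hasFDerivAt_gradient (hu : ContDiffAt ℝ 3 u x) :
    HasFDerivAt (gradient u) (fderiv ℝ (gradient u) x) x :=
  ((contDiffAt_gradient hu).differentiableAt (by norm_num)).hasFDerivAt

lemma inner_fderiv_gradient (hu : ContDiffAt ℝ 3 u x) (h k : EuclideanSpace ℝ (Fin n)) :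
    ⟪fderiv ℝ (gradient u) x h, k⟫ = fderiv ℝ (fderiv ℝ u) x h k := by
  have h2 : HasFDerivAt (fderiv ℝ u) (fderiv ℝ (fderiv ℝ u) x) x :=
    ((hu.fderiv_right (m := 2) (by norm_num)).differentiableAt (by norm_num)).hasFDerivAt
  have h3 := (hasFDerivAt_gradient hu).inner ℝ (hasFDerivAt_const k x)
  have h4 := h2.clm_apply (hasFDerivAt_const k x)
  have := congrArg (fun l => l h) (h3.unique (h4.congr_of_eventuallyEq
    (Eventually.of_forall fun y => inner_gradient y k)))
  simpa using this

lemma fderiv_gradient_symm (hu : ContDiffAt ℝ 3 u x) (h k : EuclideanSpace ℝ (Fin n)) :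
    ⟪fderiv ℝ (gradient u) x h, k⟫ = ⟪h, fderiv ℝ (gradient u) x k⟫ := by
  rw [inner_fderiv_gradient hu, real_inner_comm, inner_fderiv_gradient hu]
  exact (hu.isSymmSndFDerivAt (by simp; norm_num)).eq h k

lemma fderiv_fderiv_gradient_comm (hu : ContDiffAt ℝ 3 u x) (h k : EuclideanSpace ℝ (Fin n)) :
    fderiv ℝ (fderiv ℝ (gradient u)) x h k = fderiv ℝ (fderiv ℝ (gradient u)) x k h :=
  ((contDiffAt_gradient hu).isSymmSndFDerivAt (by simp)).eq h k

lemma hasFDerivAt_fderiv_gradient (hu : ContDiffAt ℝ 3 u x) :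
    HasFDerivAt (fderiv ℝ (gradient u)) (fderiv ℝ (fderiv ℝ (gradient u)) x) x :=
  (((contDiffAt_gradient hu).fderiv_right (m := 1) (by norm_num)).differentiableAt
    (by norm_num)).hasFDerivAt

lemma fderiv_fderiv_gradient_symm (hu : ∀ᶠ y in 𝓝 x, ContDiffAt ℝ 3 u y)
    (h k l : EuclideanSpace ℝ (Fin n)) :
    ⟪fderiv ℝ (fderiv ℝ (gradient u)) x h k, l⟫ =
      ⟪k, fderiv ℝ (fderiv ℝ (gradient u)) x h l⟫ := by
  have h0 := hasFDerivAt_fderiv_gradient hu.self_of_nhds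
  have h1 := (h0.clm_apply (hasFDerivAt_const k x)).inner ℝ (hasFDerivAt_const l x)
  have h2 := (hasFDerivAt_const k x).inner ℝ (h0.clm_apply (hasFDerivAt_const l x))
  have := congrArg (fun L => L h) (h1.unique (h2.congr_of_eventuallyEq
    (hu.mono fun y hy => fderiv_gradient_symm hy k l)))
  simpa using this

lemma pd2_eq_inner (hu : ContDiffAt ℝ 3 u x) (i j : Fin n) :
    pd2 u i j x = fderiv ℝ (gradient u) x (EuclideanSpace.single i 1) j := by
  have h3 := (hasFDerivAt_gradient hu).inner ℝ (hasFDerivAt_const (EuclideanSpace.single j (1 : ℝ)) x)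
  have h4 : (pd1 u j) = fun y => ⟪gradient u y, EuclideanSpace.single j (1 : ℝ)⟫ := by
    funext y; rw [inner_gradient]; rfl
  rw [pd2, h4, h3.fderiv]
  simp [EuclideanSpace.inner_single_right]

lemma mcOp_eq (hu : ContDiffAt ℝ 3 u x) :
    mcOp u x = ∑ i, ⟪fderiv ℝ (gradient u) x (EuclideanSpace.single i 1),
        EuclideanSpace.single i (1 : ℝ)⟫
      - ⟪fderiv ℝ (gradient u) x (gradient u x), gradient u x⟫ / (1 + ‖gradient u x‖ ^ 2) := by
  set A := fderiv ℝ (gradient u) x with hA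
  set p := gradient u x with hp
  have hsum : ∑ k, p k • EuclideanSpace.single k (1 : ℝ) = p := by
    simpa using (EuclideanSpace.basisFun (Fin n) ℝ).sum_repr p
  have hApp : ⟪A p, p⟫ = ∑ i, ∑ j, p i * p j * A (EuclideanSpace.single i 1) j := by
    have : A p = ∑ i, p i • A (EuclideanSpace.single i 1) := by
      conv_lhs => rw [← hsum]
      simp
    rw [this, sum_inner]
    refine Finset.sum_congr rfl fun i _ => ?_
    rw [real_inner_smul_left, PiLp.inner_apply, Finset.mul_sum]
    refine Finset.sum_congr rfl fun j _ => ?_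
    simp
    ring
  simp only [mcOp, aCoef, pd2_eq_inner hu, pd1_eq_inner, ← hA, ← hp, sub_mul,
    Finset.sum_sub_distrib, hApp, Finset.sum_div]
  congr 1
  · refine Finset.sum_congr rfl fun i _ => ?_
    simp [EuclideanSpace.inner_single_right]
  · refine Finset.sum_congr rfl fun i _ => Finset.sum_congr rfl fun j _ => ?_
    ring

end Gradient

section Bernstein

variable {n : ℕ} {u : EuclideanSpace ℝ (Fin n) → ℝ} {x : EuclideanSpace ℝ (Fin n)}

lemma hasDerivAt_line {F : Type*} [NormedAddCommGroup F] [NormedSpace ℝ F]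
    {f : EuclideanSpace ℝ (Fin n) → F} {f' : EuclideanSpace ℝ (Fin n) →L[ℝ] F}
    {h : EuclideanSpace ℝ (Fin n)} {t : ℝ} (hf : HasFDerivAt f f' (x + t • h)) :
    HasDerivAt (fun s : ℝ => f (x + s • h)) (f' h) t := by
  have hl : HasDerivAt (fun s : ℝ => x + s • h) h t := by
    simpa using ((hasDerivAt_id t).smul_const h).const_add x
  exact hf.comp_hasDerivAt t hl

lemma tendsto_line (x h : EuclideanSpace ℝ (Fin n)) :
    Tendsto (fun s : ℝ => x + s • h) (𝓝 0) (𝓝 x) := by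
  have : Continuous fun s : ℝ => x + s • h := by fun_prop
  simpa using this.tendsto 0

/-- The equation differentiated in the direction of the gradient. -/
lemma fderiv_mcOp_gradient {θ : ℝ} (hu : ∀ᶠ y in 𝓝 x, ContDiffAt ℝ 3 u y)
    (hx : gradient u x ≠ 0)
    (heq : ∀ᶠ y in 𝓝 x, mcOp u y = √(1 + ‖gradient u y‖ ^ 2) *
        Real.log (1 + ‖gradient u y‖ ^ 2) ^ θ)
    {p : EuclideanSpace ℝ (Fin n)} (hp : p = gradient u x)
    {A : EuclideanSpace ℝ (Fin n) →L[ℝ] EuclideanSpace ℝ (Fin n)}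
    (hA : A = fderiv ℝ (gradient u) x)
    {T : EuclideanSpace ℝ (Fin n) →L[ℝ] EuclideanSpace ℝ (Fin n) →L[ℝ] EuclideanSpace ℝ (Fin n)}
    (hT : T = fderiv ℝ (fderiv ℝ (gradient u)) x) :
    ∑ i, ⟪T p (EuclideanSpace.single i 1), EuclideanSpace.single i (1 : ℝ)⟫
      - ⟪T p p, p⟫ / (1 + ‖p‖ ^ 2) =
      2 * ‖A p‖ ^ 2 / (1 + ‖p‖ ^ 2) - 2 * ⟪A p, p⟫ ^ 2 / (1 + ‖p‖ ^ 2) ^ 2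
      + ⟪A p, p⟫ / √(1 + ‖p‖ ^ 2) * (Real.log (1 + ‖p‖ ^ 2) ^ θ
        + 2 * θ * Real.log (1 + ‖p‖ ^ 2) ^ (θ - 1)) := by
  have hP : HasDerivAt (fun t : ℝ => gradient u (x + t • p)) (A p) 0 := by
    refine hasDerivAt_line ?_
    rw [hA]; simpa using hasFDerivAt_gradient hu.self_of_nhds
  have hDP : HasDerivAt (fun t : ℝ => fderiv ℝ (gradient u) (x + t • p)) (T p) 0 := by
    refine hasDerivAt_line ?_
    rw [hT]; simpa using hasFDerivAt_fderiv_gradient hu.self_of_nhds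
  have hv : HasDerivAt (fun t : ℝ => 1 + ‖gradient u (x + t • p)‖ ^ 2) (2 * ⟪A p, p⟫) 0 := by
    exact (hP.norm_sq.const_add 1).congr_deriv (by simp [hp])
  have hv0 : 0 < 1 + ‖p‖ ^ 2 := by positivity
  have hL0 : 0 < Real.log (1 + ‖p‖ ^ 2) :=
    Real.log_pos (by have := norm_pos_iff.2 (hp ▸ hx : p ≠ 0); nlinarith)
  have hval : 1 + ‖gradient u (x + (0 : ℝ) • p)‖ ^ 2 = 1 + ‖p‖ ^ 2 := by simp [hp]
  have hR := (hv.sqrt (by rw [hval]; exact hv0.ne')).mul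
    ((hv.log (by rw [hval]; exact hv0.ne')).rpow_const (p := θ)
      (Or.inl (by rw [hval]; exact hL0.ne')))
  have hS : HasDerivAt (fun t : ℝ => ∑ i, ⟪fderiv ℝ (gradient u) (x + t • p)
      (EuclideanSpace.single i 1), EuclideanSpace.single i (1 : ℝ)⟫)
      (∑ i, ⟪T p (EuclideanSpace.single i 1), EuclideanSpace.single i (1 : ℝ)⟫) 0 := by
    refine HasDerivAt.fun_sum fun i _ => ?_
    exact ((hDP.clm_apply (hasDerivAt_const 0 (EuclideanSpace.single i (1 : ℝ)))).inner ℝ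
      (hasDerivAt_const 0 (EuclideanSpace.single i (1 : ℝ)))).congr_deriv (by simp)
  have hL := hS.sub (((hDP.clm_apply hP).inner ℝ hP).div hv (by rw [hval]; exact hv0.ne'))
  have hE := hL.unique (hR.congr_of_eventuallyEq ?_)
  · simp only [zero_smul, add_zero, ← hp, ← hA] at hE
    have hsym : ⟪A (A p), p⟫ = ‖A p‖ ^ 2 := by
      rw [hA, fderiv_gradient_symm hu.self_of_nhds, real_inner_self_eq_norm_sq]
    rw [inner_add_left, hsym, real_inner_self_eq_norm_sq] at hE
    have hσ : 0 < √(1 + ‖p‖ ^ 2) := Real.sqrt_pos.2 hv0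
    have hσ2 : √(1 + ‖p‖ ^ 2) ^ 2 = 1 + ‖p‖ ^ 2 := Real.sq_sqrt hv0.le
    rw [← hσ2] at hE ⊢
    set σ := √(1 + ‖p‖ ^ 2)
    rw [← sub_eq_zero] at hE ⊢
    rw [← hE, Real.sqrt_sq hσ.le]
    field_simp
    ring
  · filter_upwards [(tendsto_line x p).eventually hu, (tendsto_line x p).eventually heq]
      with t h1 h2
    simp only [Pi.sub_apply, Pi.mul_apply, Pi.div_apply]
    rw [← h2, mcOp_eq h1]

/-- First and second order conditions at a maximum of
`log log (1 + |∇u|²) + m log (R² - |· - z|²)`. -/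
lemma bernstein_max_conditions {m R : ℝ} {z : EuclideanSpace ℝ (Fin n)}
    (hu : ∀ᶠ y in 𝓝 x, ContDiffAt ℝ 3 u y) (hx : gradient u x ≠ 0)
    (hR : 0 < R ^ 2 - ‖x - z‖ ^ 2)
    (hmax : IsLocalMax (fun y => Real.log (Real.log (1 + ‖gradient u y‖ ^ 2))
      + m * Real.log (R ^ 2 - ‖y - z‖ ^ 2)) x)
    {p : EuclideanSpace ℝ (Fin n)} (hp : p = gradient u x)
    {A : EuclideanSpace ℝ (Fin n) →L[ℝ] EuclideanSpace ℝ (Fin n)}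
    (hA : A = fderiv ℝ (gradient u) x)
    {T : EuclideanSpace ℝ (Fin n) →L[ℝ] EuclideanSpace ℝ (Fin n) →L[ℝ] EuclideanSpace ℝ (Fin n)}
    (hT : T = fderiv ℝ (fderiv ℝ (gradient u)) x) {ρ L : ℝ} (hρ : ρ = R ^ 2 - ‖x - z‖ ^ 2)
    (hL : L = Real.log (1 + ‖p‖ ^ 2)) (h : EuclideanSpace ℝ (Fin n)) :
    2 * ⟪A h, p⟫ / (1 + ‖p‖ ^ 2) = L * m * (2 * ⟪h, x - z⟫ / ρ) ∧
    (2 * ‖A h‖ ^ 2 + 2 * ⟪T h h, p⟫) / (1 + ‖p‖ ^ 2)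
        - 4 * ⟪A h, p⟫ ^ 2 / (1 + ‖p‖ ^ 2) ^ 2 ≤
      L * ((m ^ 2 + m) * (4 * ⟪h, x - z⟫ ^ 2 / ρ ^ 2) + 2 * m * ‖h‖ ^ 2 / ρ) := by
  have hv0 : 0 < 1 + ‖p‖ ^ 2 := by positivity
  have hL0 : 0 < L := by
    rw [hL]
    exact Real.log_pos (by have := norm_pos_iff.2 (hp ▸ hx : p ≠ 0); nlinarith)
  have hcont : ContinuousAt (gradient u) x :=
    (contDiffAt_gradient hu.self_of_nhds).continuousAt
  have hLev : ∀ᶠ y in 𝓝 x, 0 < Real.log (1 + ‖gradient u y‖ ^ 2) := by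
    filter_upwards [hcont.eventually_ne hx] with y hy
    exact Real.log_pos (by have := norm_pos_iff.2 hy; nlinarith)
  have hρev : ∀ᶠ y in 𝓝 x, 0 < R ^ 2 - ‖y - z‖ ^ 2 := by
    have : Continuous fun y => R ^ 2 - ‖y - z‖ ^ 2 := by fun_prop
    exact this.continuousAt.eventually (lt_mem_nhds hR)
  have hρ0 : 0 < ρ := hρ ▸ hR
  have hl := tendsto_line x h
  -- derivatives along the line
  have hP : ∀ t : ℝ, ContDiffAt ℝ 3 u (x + t • h) →
      HasDerivAt (fun t : ℝ => gradient u (x + t • h)) (fderiv ℝ (gradient u) (x + t • h) h) t :=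
    fun t ht => hasDerivAt_line (hasFDerivAt_gradient ht)
  have hv : ∀ t : ℝ, ContDiffAt ℝ 3 u (x + t • h) →
      HasDerivAt (fun t : ℝ => 1 + ‖gradient u (x + t • h)‖ ^ 2)
        (2 * ⟪fderiv ℝ (gradient u) (x + t • h) h, gradient u (x + t • h)⟫) t := by
    intro t ht
    exact ((hP t ht).norm_sq.const_add 1).congr_deriv (by rw [real_inner_comm])
  have hline : ∀ t : ℝ, HasDerivAt (fun t : ℝ => x + t • h - z) h t := fun t => by
    simpa using (((hasDerivAt_id t).smul_const h).const_add x).sub_const z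
  have hη : ∀ t : ℝ, HasDerivAt (fun t : ℝ => R ^ 2 - ‖x + t • h - z‖ ^ 2)
      (-(2 * ⟪h, x + t • h - z⟫)) t := by
    intro t
    exact ((hline t).norm_sq.const_sub (R ^ 2)).congr_deriv (by rw [real_inner_comm])
  have h1 : ∀ᶠ t in 𝓝 (0 : ℝ), HasDerivAt (fun t : ℝ =>
      Real.log (Real.log (1 + ‖gradient u (x + t • h)‖ ^ 2))
        + m * Real.log (R ^ 2 - ‖x + t • h - z‖ ^ 2))
      (2 * ⟪fderiv ℝ (gradient u) (x + t • h) h, gradient u (x + t • h)⟫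
        / (1 + ‖gradient u (x + t • h)‖ ^ 2) / Real.log (1 + ‖gradient u (x + t • h)‖ ^ 2)
        + m * (-(2 * ⟪h, x + t • h - z⟫) / (R ^ 2 - ‖x + t • h - z‖ ^ 2))) t := by
    filter_upwards [hl.eventually hu, hl.eventually hLev, hl.eventually hρev] with t a1 a2 a3
    exact (((hv t a1).log (by positivity)).log a2.ne').add
      (((hη t).log a3.ne').const_mul m)
  have hmax' : IsLocalMax (fun t : ℝ =>
      Real.log (Real.log (1 + ‖gradient u (x + t • h)‖ ^ 2))
        + m * Real.log (R ^ 2 - ‖x + t • h - z‖ ^ 2)) 0 := by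
    have := hl.eventually hmax
    simpa [IsLocalMax, IsMaxFilter] using this
  have hval : 1 + ‖gradient u (x + (0 : ℝ) • h)‖ ^ 2 = 1 + ‖p‖ ^ 2 := by simp [hp]
  have first := hmax'.hasDerivAt_eq_zero h1.self_of_nhds
  have hu0 : ContDiffAt ℝ 3 u (x + (0 : ℝ) • h) := by simpa using hu.self_of_nhds
  have hDP : HasDerivAt (fun t : ℝ => fderiv ℝ (gradient u) (x + t • h) h) (T h h) 0 := by
    have : HasDerivAt (fun t : ℝ => fderiv ℝ (gradient u) (x + t • h)) (T h) 0 := by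
      refine hasDerivAt_line ?_
      rw [hT]; simpa using hasFDerivAt_fderiv_gradient hu.self_of_nhds
    simpa using this.clm_apply (hasDerivAt_const 0 h)
  have h2a := ((((hDP.inner ℝ (hP 0 hu0)).const_mul 2).div (hv 0 hu0) (by positivity)).div
    ((hv 0 hu0).log (by positivity)) (by rw [hval, ← hL]; exact hL0.ne'))
  have h2b := ((((hasDerivAt_const (0 : ℝ) h).inner ℝ (hline 0)).const_mul 2).neg.div (hη 0)
    (by simpa using hR.ne')).const_mul m
  have second := hmax'.second_deriv_nonpos h1 (h2a.add h2b)
  simp only [Pi.div_apply, Pi.neg_apply, zero_smul, add_zero, ← hp, ← hA, ← hL, ← hρ]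
    at first second
  simp only [inner_zero_left, add_zero, real_inner_self_eq_norm_sq] at second
  have e1 : 2 * ⟪A h, p⟫ / (1 + ‖p‖ ^ 2) = L * m * (2 * ⟪h, x - z⟫ / ρ) := by
    have hcalc : 2 * ⟪A h, p⟫ / (1 + ‖p‖ ^ 2) =
        L * (2 * ⟪A h, p⟫ / (1 + ‖p‖ ^ 2) / L) := by field_simp
    rw [hcalc, eq_neg_of_add_eq_zero_left first]
    ring
  refine ⟨e1, ?_⟩
  have e2 : (2 * ‖A h‖ ^ 2 + 2 * ⟪T h h, p⟫) / (1 + ‖p‖ ^ 2)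
        - 4 * ⟪A h, p⟫ ^ 2 / (1 + ‖p‖ ^ 2) ^ 2 =
      L * (((2 * (‖A h‖ ^ 2 + ⟪T h h, p⟫)) * (1 + ‖p‖ ^ 2)
        - 2 * ⟪A h, p⟫ * (2 * ⟪A h, p⟫)) / (1 + ‖p‖ ^ 2) ^ 2 / L) := by
    field_simp
    ring
  rw [e2]
  refine mul_le_mul_of_nonneg_left ?_ hL0.le
  rw [← sub_nonpos]
  refine le_of_eq_of_le ?_ second
  rw [e1]
  field_simp
  ring

/-- The inequality obtained at an interior maximum by summing the second order conditions over
a frame adapted to the operator. -/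
lemma bernstein_estimate {θ m R : ℝ} (hm : 0 < m) (hR0 : 0 < R) (hθ : 0 ≤ θ) (hn : 1 ≤ n)
    {z : EuclideanSpace ℝ (Fin n)}
    (hu : ∀ᶠ y in 𝓝 x, ContDiffAt ℝ 3 u y) (hx : gradient u x ≠ 0)
    (heq : ∀ᶠ y in 𝓝 x, mcOp u y = √(1 + ‖gradient u y‖ ^ 2) *
        Real.log (1 + ‖gradient u y‖ ^ 2) ^ θ)
    (hR : 0 < R ^ 2 - ‖x - z‖ ^ 2)
    (hmax : IsLocalMax (fun y => Real.log (Real.log (1 + ‖gradient u y‖ ^ 2))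
      + m * Real.log (R ^ 2 - ‖y - z‖ ^ 2)) x)
    {ρ L : ℝ} (hρ : ρ = R ^ 2 - ‖x - z‖ ^ 2) (hL : L = Real.log (1 + ‖gradient u x‖ ^ 2)) :
    2 / n * (L ^ θ) ^ 2 ≤ L * (2 * m * (R / ρ) * (L ^ θ + 2 * θ * L ^ (θ - 1))
      + (m ^ 2 + m) * (4 * (R / ρ) ^ 2) + 2 * m * n / ρ) := by
  obtain ⟨p, hp⟩ : ∃ p, p = gradient u x := ⟨_, rfl⟩
  obtain ⟨A, hA⟩ : ∃ A, A = fderiv ℝ (gradient u) x := ⟨_, rfl⟩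
  obtain ⟨T, hT⟩ : ∃ T, T = fderiv ℝ (fderiv ℝ (gradient u)) x := ⟨_, rfl⟩
  rw [← hp] at hL
  have hρ0 : 0 < ρ := hρ ▸ hR
  have hV0 : 0 < 1 + ‖p‖ ^ 2 := by positivity
  have hL0 : 0 < L := by
    rw [hL]
    exact Real.log_pos (by have := norm_pos_iff.2 (hp ▸ hx : p ≠ 0); nlinarith)
  have hn0 : (0 : ℝ) < n := by exact_mod_cast hn
  have hmc := bernstein_max_conditions hu hx hR hmax hp hA hT hρ hL
  have hdiff := fderiv_mcOp_gradient hu hx heq hp hA hT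
  have heqx := heq.self_of_nhds
  rw [mcOp_eq hu.self_of_nhds, ← hp, ← hA, ← hL] at heqx
  rw [← hL] at hdiff
  have hAsymm : ∀ h k, ⟪A h, k⟫ = ⟪h, A k⟫ := by
    rw [hA]; exact fderiv_gradient_symm hu.self_of_nhds
  obtain ⟨b, hb⟩ := exists_frame_sum p
  set V := 1 + ‖p‖ ^ 2 with hV
  set σ := √V with hσ
  have hσ0 : 0 < σ := Real.sqrt_pos.2 hV0
  have hσ2 : σ ^ 2 = V := Real.sq_sqrt hV0.le
  set G := L ^ θ + 2 * θ * L ^ (θ - 1) with hG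
  have hG0 : 0 ≤ G := by positivity
  have bT : ∑ k, ⟪T (b k) (b k), p⟫ =
      2 * ‖A p‖ ^ 2 / V - 2 * ⟪A p, p⟫ ^ 2 / V ^ 2 + ⟪A p, p⟫ / σ * G := by
    rw [← hdiff]
    have := hb (LinearMap.mk₂ ℝ (fun h k => ⟪T h k, p⟫)
      (by intros; simp [inner_add_left]) (by intros; simp [inner_smul_left])
      (by intros; simp [inner_add_left]) (by intros; simp [inner_smul_left]))
    simp only [LinearMap.mk₂_apply] at this
    rw [this]
    congr 1
    refine Finset.sum_congr rfl fun k _ => ?_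
    rw [hT, fderiv_fderiv_gradient_symm hu, fderiv_fderiv_gradient_comm hu.self_of_nhds,
      real_inner_comm]
  have bI : ∑ k, ‖b k‖ ^ 2 ≤ n := by
    have := hb (innerₗ (EuclideanSpace ℝ (Fin n)))
    simp only [innerₗ_apply_apply, real_inner_self_eq_norm_sq] at this
    rw [this]
    have : 0 ≤ ‖p‖ ^ 2 / V := by positivity
    simpa using this
  have bq : ∀ q : EuclideanSpace ℝ (Fin n), ∑ k, ⟪b k, q⟫ ^ 2 = ‖q‖ ^ 2 - ⟪p, q⟫ ^ 2 / V := by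
    intro q
    have := hb (LinearMap.mk₂ ℝ (fun h k => ⟪h, q⟫ * ⟪k, q⟫)
      (by intros; simp [inner_add_left, add_mul])
      (by intros; simp [inner_smul_left, mul_assoc])
      (by intros; simp [inner_add_left, mul_add])
      (by intros; simp [inner_smul_left, mul_left_comm]))
    simp only [LinearMap.mk₂_apply, ← sq] at this
    rw [this, EuclideanSpace.real_norm_sq_eq]
    simp [EuclideanSpace.inner_single_left]
  have bA : ∑ k, ⟪A (b k), b k⟫ = σ * L ^ θ := by
    rw [← heqx]
    have := hb (LinearMap.mk₂ ℝ (fun h k => ⟪A h, k⟫)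
      (by intros; simp [inner_add_left]) (by intros; simp [inner_smul_left])
      (by intros; simp [inner_add_right]) (by intros; simp [inner_smul_right]))
    simpa only [LinearMap.mk₂_apply] using this
  set X := ∑ k, ‖A (b k)‖ ^ 2 with hX
  have hXlow : V * (L ^ θ) ^ 2 ≤ n * X := by
    calc V * (L ^ θ) ^ 2 = (∑ k, ⟪A (b k), b k⟫) ^ 2 := by rw [bA, mul_pow, hσ2]
      _ ≤ (∑ k, ‖A (b k)‖ * ‖b k‖) ^ 2 := by
        refine sq_le_sq' ?_ (Finset.sum_le_sum fun k _ => real_inner_le_norm _ _)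
        rw [← Finset.sum_neg_distrib]
        exact Finset.sum_le_sum fun k _ => neg_le_of_abs_le (abs_real_inner_le_norm _ _)
      _ ≤ X * ∑ k, ‖b k‖ ^ 2 := Finset.sum_mul_sq_le_sq_mul_sq _ _ _
      _ ≤ X * n := by gcongr
      _ = n * X := mul_comm _ _
  have hsum := Finset.sum_le_sum fun k (_ : k ∈ Finset.univ) => (hmc (b k)).2
  have hlhs : ∑ k, ((2 * ‖A (b k)‖ ^ 2 + 2 * ⟪T (b k) (b k), p⟫) / V
      - 4 * ⟪A (b k), p⟫ ^ 2 / V ^ 2) = 2 * X / V + 2 * ⟪A p, p⟫ / V * (G / σ) := by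
    simp only [hAsymm (b _) p, Finset.sum_sub_distrib, ← Finset.sum_div, Finset.sum_add_distrib,
      ← Finset.mul_sum, bT, bq]
    rw [real_inner_comm (A p) p]
    field_simp
    ring
  have hy : ‖x - z‖ ≤ R := (sq_le_sq₀ (norm_nonneg _) hR0.le).1 (by linarith)
  have hrhs : ∑ k, L * ((m ^ 2 + m) * (4 * ⟪b k, x - z⟫ ^ 2 / ρ ^ 2) + 2 * m * ‖b k‖ ^ 2 / ρ)
      ≤ L * ((m ^ 2 + m) * (4 * (R / ρ) ^ 2) + 2 * m * n / ρ) := by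
    simp only [← Finset.mul_sum, Finset.sum_add_distrib, ← Finset.sum_div, bq]
    rw [div_pow, ← mul_div_assoc, ← mul_div_assoc, ← mul_div_assoc]
    gcongr
    have h1 : 0 ≤ ⟪p, x - z⟫ ^ 2 / V := by positivity
    have h2 := pow_le_pow_left₀ (norm_nonneg _) hy 2
    linarith
  rw [hlhs, (hmc p).1] at hsum
  have hpσ : ‖p‖ ≤ σ := Real.le_sqrt_of_sq_le (by rw [hV]; linarith)
  have hinner : -(σ * R) ≤ ⟪p, x - z⟫ :=
    (neg_le_neg (mul_le_mul hpσ hy (norm_nonneg _) hσ0.le)).trans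
      (neg_le_of_abs_le (abs_real_inner_le_norm _ _))
  have hcross : -(L * (2 * m * (R / ρ) * G)) ≤ L * m * (2 * ⟪p, x - z⟫ / ρ) * (G / σ) := by
    have : -(L * (2 * m * (R / ρ) * G)) = L * m * (2 * -(σ * R) / ρ) * (G / σ) := by
      field_simp
    rw [this]
    refine mul_le_mul_of_nonneg_right (mul_le_mul_of_nonneg_left ?_ (by positivity))
      (by positivity)
    exact div_le_div_of_nonneg_right (by linarith) hρ0.le
  have hX2 : 2 / n * (L ^ θ) ^ 2 ≤ 2 * X / V := by
    rw [div_mul_eq_mul_div, div_le_div_iff₀ hn0 hV0]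
    linarith
  have := hsum.trans hrhs
  linarith

end Bernstein

/-- Interior maximum principle for the Bernstein function on a ball of radius `R`. -/
lemma bernstein_ball_bound {n : ℕ} (hn : 1 ≤ n) {θ : ℝ} (hθ : 1 < θ)
    {u : EuclideanSpace ℝ (Fin n) → ℝ} (hu1 : ContDiff ℝ 1 u)
    (hu3 : ContDiffOn ℝ 3 u {x | gradient u x ≠ 0})
    (heq : ∀ x : EuclideanSpace ℝ (Fin n), gradient u x ≠ 0 →
      mcOp u x = √(1 + ‖gradient u x‖ ^ 2) * Real.log (1 + ‖gradient u x‖ ^ 2) ^ θ)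
    {z : EuclideanSpace ℝ (Fin n)} {ε : ℝ} (hε : ε = Real.log (1 + ‖gradient u z‖ ^ 2))
    (hε0 : 0 < ε) {m : ℝ} (hm : m = 1 / (θ - 1)) {R : ℝ} (hR : 0 < R) :
    2 / n ≤ 2 * m * (1 + 2 * θ / ε) * (ε ^ (1 - θ) / R)
      + (4 * m ^ 2 + 4 * m + 2 * m * n) / ε * (ε ^ (1 - θ) / R) ^ 2 := by
  have hτ : 0 < θ - 1 := by linarith
  have hm0 : 0 < m := by rw [hm]; positivity
  have hn0 : (0 : ℝ) < n := by exact_mod_cast hn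
  have hgc := continuous_gradient_of_contDiff hu1
  have hVne : ∀ y, (1 : ℝ) + ‖gradient u y‖ ^ 2 ≠ 0 := fun y => by positivity
  have hFc : Continuous fun y => Real.log (1 + ‖gradient u y‖ ^ 2) * (R ^ 2 - ‖y - z‖ ^ 2) ^ m := by
    refine ((continuous_const.add (hgc.norm.pow 2)).log hVne).mul ?_
    exact Continuous.rpow_const (by fun_prop) fun _ => Or.inr hm0.le
  obtain ⟨x, hxB, hxmax⟩ := (isCompact_closedBall z R).exists_isMaxOn
    ⟨z, mem_closedBall_self hR.le⟩ hFc.continuousOn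
  have hxz := hxmax (mem_closedBall_self hR.le)
  simp only [Set.mem_ofPred_eq, sub_self, norm_zero, ← hε] at hxz
  rw [mem_closedBall, dist_eq_norm] at hxB
  obtain ⟨L, hL⟩ : ∃ L, L = Real.log (1 + ‖gradient u x‖ ^ 2) := ⟨_, rfl⟩
  obtain ⟨ρ, hρ⟩ : ∃ ρ, ρ = R ^ 2 - ‖x - z‖ ^ 2 := ⟨_, rfl⟩
  rw [← hL, ← hρ] at hxz
  have hρnn : 0 ≤ ρ := by rw [hρ]; nlinarith [norm_nonneg (x - z)]
  have hρR : ρ ≤ R ^ 2 := by rw [hρ]; nlinarith [norm_nonneg (x - z)]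
  have hLnn : 0 ≤ L := by rw [hL]; exact Real.log_nonneg (by nlinarith [norm_nonneg (gradient u x)])
  have hpos : 0 < L * ρ ^ m := lt_of_lt_of_le (by norm_num; positivity) hxz
  have hL0 : 0 < L := lt_of_le_of_ne hLnn (by rintro h; simp [← h] at hpos)
  have hρ0 : 0 < ρ := lt_of_le_of_ne hρnn (by
    rintro h; simp [← h, Real.zero_rpow hm0.ne'] at hpos)
  have hgx : gradient u x ≠ 0 := by
    rintro h; simp [hL, h] at hL0
  have hopen : IsOpen {x | gradient u x ≠ 0} := isOpen_ne_fun hgc continuous_const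
  have hev : ∀ᶠ y in 𝓝 x, gradient u y ≠ 0 := hopen.mem_nhds hgx
  have hρx : 0 < R ^ 2 - ‖x - z‖ ^ 2 := hρ ▸ hρ0
  have hρev : ∀ᶠ y in 𝓝 x, 0 < R ^ 2 - ‖y - z‖ ^ 2 := by
    have : Continuous fun y => R ^ 2 - ‖y - z‖ ^ 2 := by fun_prop
    exact this.continuousAt.eventually (lt_mem_nhds hρx)
  have hmax : IsLocalMax (fun y => Real.log (Real.log (1 + ‖gradient u y‖ ^ 2))
      + m * Real.log (R ^ 2 - ‖y - z‖ ^ 2)) x := by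
    filter_upwards [hev, hρev] with y hy1 hy2
    have hLy : 0 < Real.log (1 + ‖gradient u y‖ ^ 2) :=
      Real.log_pos (by have := norm_pos_iff.2 hy1; nlinarith)
    have hyB : y ∈ closedBall z R := by
      rw [mem_closedBall, dist_eq_norm]
      nlinarith [norm_nonneg (y - z)]
    have hyx : Real.log (1 + ‖gradient u y‖ ^ 2) * (R ^ 2 - ‖y - z‖ ^ 2) ^ m ≤
        Real.log (1 + ‖gradient u x‖ ^ 2) * (R ^ 2 - ‖x - z‖ ^ 2) ^ m := hxmax hyB
    have := Real.log_le_log (by positivity) hyx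
    rw [Real.log_mul hLy.ne' (by positivity), Real.log_rpow hy2, ← hL, ← hρ,
      Real.log_mul hL0.ne' (by positivity), Real.log_rpow hρ0] at this
    rwa [← hL, ← hρ]
  have hest := bernstein_estimate hm0 hR (by linarith) hn
    (hev.mono fun y hy => hu3.contDiffAt (hopen.mem_nhds hy)) hgx (hev.mono heq)
    hρx hmax hρ hL
  -- bound of the weight through the value of the maximum
  have hle : ρ ^ m ≤ (R ^ 2) ^ m := Real.rpow_le_rpow hρ0.le hρR hm0.le
  have hRm : 0 < (R ^ 2) ^ m := by positivity
  have hxz' : ε * (R ^ 2) ^ m ≤ L * ρ ^ m := by simpa using hxz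
  have hLε : ε ≤ L := by
    have : ε * (R ^ 2) ^ m ≤ L * (R ^ 2) ^ m := hxz'.trans (by gcongr)
    exact le_of_mul_le_mul_right this hRm
  have hmτ : m * (θ - 1) = 1 := by rw [hm]; field_simp
  have hw : R ^ 2 * ε ^ (θ - 1) ≤ L ^ (θ - 1) * ρ := by
    have := Real.rpow_le_rpow (by positivity) hxz' hτ.le
    rwa [Real.mul_rpow hε0.le hRm.le, Real.mul_rpow hL0.le (by positivity),
      ← Real.rpow_mul (by positivity), ← Real.rpow_mul hρ0.le, hmτ, Real.rpow_one, Real.rpow_one,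
      mul_comm] at this
  set δ := ε ^ (1 - θ) / R with hδ
  set q := L ^ (θ - 1) with hq
  have hq0 : 0 < q := by positivity
  have hδ0 : 0 < δ := by positivity
  have hs : R / ρ ≤ δ * q := by
    have h1 : ε ^ (1 - θ) = (ε ^ (θ - 1))⁻¹ := by rw [← Real.rpow_neg hε0.le]; congr 1; ring
    have h2 : 0 < ε ^ (θ - 1) := by positivity
    rw [hδ, h1, div_mul_eq_mul_div, div_le_div_iff₀ hρ0 hR, inv_mul_eq_div, div_mul_eq_mul_div,
      le_div_iff₀ h2]
    linarith
  have hs2 : 1 / ρ ≤ (R / ρ) ^ 2 := by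
    rw [div_pow, div_le_div_iff₀ hρ0 (by positivity)]
    nlinarith
  have hLθ : L ^ θ = L * q := by
    rw [hq, ← Real.rpow_one_add' hL0.le (by linarith)]; congr 1; ring
  have hs0 : 0 ≤ R / ρ := by positivity
  have hmain : 2 / n * (L * q) ^ 2 ≤ L * (2 * m * (δ * q) * (L * q + 2 * θ * q)
      + (4 * m ^ 2 + 4 * m + 2 * m * n) * (δ * q) ^ 2) := by
    rw [hLθ] at hest
    refine hest.trans (mul_le_mul_of_nonneg_left ?_ hL0.le)
    have hsq : (R / ρ) ^ 2 ≤ (δ * q) ^ 2 := by gcongr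
    have a1 : 2 * m * (R / ρ) * (L * q + 2 * θ * q) ≤ 2 * m * (δ * q) * (L * q + 2 * θ * q) := by
      gcongr
    have a2 : (m ^ 2 + m) * (4 * (R / ρ) ^ 2) ≤ (m ^ 2 + m) * (4 * (δ * q) ^ 2) := by gcongr
    have a3 : 2 * m * n / ρ ≤ 2 * m * n * (δ * q) ^ 2 := by
      rw [div_eq_mul_one_div]
      gcongr
      exact hs2.trans hsq
    linarith
  have hmain2 : 2 / n * L ≤ 2 * m * δ * (L + 2 * θ)
      + (4 * m ^ 2 + 4 * m + 2 * m * n) * δ ^ 2 := by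
    refine le_of_mul_le_mul_left ?_ (by positivity : 0 < L * q ^ 2)
    linarith
  refine le_of_mul_le_mul_right (hmain2.trans ?_) hL0
  have e : 1 ≤ L / ε := (one_le_div hε0).2 hLε
  have b1 : 2 * m * δ * (L + 2 * θ * 1) ≤ 2 * m * δ * (L + 2 * θ * (L / ε)) := by gcongr
  have b2 : (4 * m ^ 2 + 4 * m + 2 * m * n) * δ ^ 2 * 1 ≤
      (4 * m ^ 2 + 4 * m + 2 * m * n) * δ ^ 2 * (L / ε) := by gcongr
  calc _ ≤ 2 * m * δ * (L + 2 * θ * (L / ε))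
        + (4 * m ^ 2 + 4 * m + 2 * m * n) * δ ^ 2 * (L / ε) := by linarith
    _ = _ := by ring

/-- Liouville theorem (E2): entire solutions of
`div(∇u/√(1+|∇u|²)) = log^θ(1+|∇u|²)`, `θ > 1`, are constant. -/
theorem liouville_E2 (n : ℕ) (hn : 1 ≤ n) (θ : ℝ) (hθ : 1 < θ)
    (u : EuclideanSpace ℝ (Fin n) → ℝ)
    (hu1 : ContDiff ℝ 1 u)
    (hu3 : ContDiffOn ℝ 3 u {x | gradient u x ≠ 0})
    (heq : ∀ x : EuclideanSpace ℝ (Fin n), gradient u x ≠ 0 →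
      mcOp u x = Real.sqrt (1 + ‖gradient u x‖ ^ 2) *
        Real.log (1 + ‖gradient u x‖ ^ 2) ^ θ) :
    ∃ c : ℝ, ∀ x, u x = c := by
  have hgrad : ∀ z, gradient u z = 0 := by
    intro z
    by_contra hz
    obtain ⟨ε, hε⟩ : ∃ ε, ε = Real.log (1 + ‖gradient u z‖ ^ 2) := ⟨_, rfl⟩
    have hε0 : 0 < ε := by
      rw [hε]
      exact Real.log_pos (by have := norm_pos_iff.2 hz; nlinarith)
    have hbound := fun R (hR : 0 < R) =>
      bernstein_ball_bound hn hθ hu1 hu3 heq hε hε0 rfl hR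
    have hδ : Tendsto (fun R : ℝ => ε ^ (1 - θ) / R) atTop (𝓝 0) :=
      tendsto_const_nhds.div_atTop tendsto_id
    have hlim := (hδ.const_mul (2 * (1 / (θ - 1)) * (1 + 2 * θ / ε))).add ((hδ.pow 2).const_mul
      ((4 * (1 / (θ - 1)) ^ 2 + 4 * (1 / (θ - 1)) + 2 * (1 / (θ - 1)) * n) / ε))
    have := ge_of_tendsto hlim ((eventually_gt_atTop 0).mono hbound)
    have hn0 : (0 : ℝ) < 2 / n := by
      have : (0 : ℝ) < n := by exact_mod_cast hn
      positivity
    norm_num at this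
    linarith
  refine ⟨u 0, fun x => is_const_of_fderiv_eq_zero (𝕜 := ℝ)
    (hu1.differentiable (by norm_num)) (fun y => ?_) x 0⟩
  ext h
  rw [← inner_gradient, hgrad]
  simp
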